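/- Let G = (V,E) be a finite simple graph with T triangles and arboricity at most α, and let τ > 0. Then the number of τ-heavy triangles of G is at most 3Tα/τ. -/

import Mathlib

open Finset SimpleGraph
open scoped Classical

/-- The number of triangles (3-cliques) of `G` that contain the pair `e`. -/
noncomputable def triCount {V : Type*} [Fintype V] [DecidableEq V]
    (G : SimpleGraph V) [DecidableRel G.Adj] (e : Sym2 V) : ℕ :=
  ((G.cliqueFinset 3).filter (fun t => ∀ v ∈ e, v ∈ t)).card

/-- `G` has arboricity at most `a`: its edge set can be partitioned into `a` forests. -/
def ArboricityLE {V : Type*} (G : SimpleGraph V) (a : ℕ) : Prop :=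
  ∃ F : Fin a → SimpleGraph V,
    (∀ i, F i ≤ G) ∧ (∀ i, (F i).IsAcyclic) ∧
      ∀ e ∈ G.edgeSet, ∃! i, e ∈ (F i).edgeSet

/-- The arboricity of `G`: the minimum number of forests into which the edge set of `G`
can be partitioned. -/
noncomputable def arboricity {V : Type*} (G : SimpleGraph V) : ℕ :=
  sInf {a | ArboricityLE G a}

/-- A triangle `t` of `G` is τ-heavy if all three of its edges are τ-heavy
(i.e. each edge of `t` lies in more than `τ` triangles). -/
noncomputable def IsHeavyTriangle {V : Type*} [Fintype V] [DecidableEq V]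
    (G : SimpleGraph V) [DecidableRel G.Adj] (τ : ℝ) (t : Finset V) : Prop :=
  ∀ u ∈ t, ∀ v ∈ t, u ≠ v → τ < (triCount G s(u, v) : ℝ)

/-- The edges of a forest can be oriented so that every vertex has out-degree at most one:
`p u` is the out-neighbour of `u`. -/
theorem SimpleGraph.IsAcyclic.exists_parent {V : Type*} {F : SimpleGraph V} (hF : F.IsAcyclic) :
    ∃ p : V → V, ∀ u v, F.Adj u v → p u = v ∨ p v = u := by
  have root : ∀ v, F.Reachable v (F.connectedComponentMk v).out := fun v =>
    (ConnectedComponent.exact (Quot.out_eq (F.connectedComponentMk v))).symm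
  choose q hq using fun v => (root v).exists_isPath
  refine ⟨fun v => (q v).snd, fun u v huv => ?_⟩
  by_cases hv : v ∈ (q u).support
  · exact Or.inl (hF.eq_snd_of_adj_start (hq u) huv hv).symm
  · refine Or.inr (hF.eq_snd_of_adj_start (hq v) huv.symm ?_).symm
    have hroot : (F.connectedComponentMk u).out = (F.connectedComponentMk v).out := by
      rw [ConnectedComponent.sound huv.reachable]
    have hpath : ((Walk.cons huv.symm (q u)).copy rfl hroot).IsPath := by
      simpa [Walk.cons_isPath_iff] using ⟨hq u, hv⟩
    have heq := congrArg Subtype.val ((hF.subsingleton_path _ _).elim ⟨_, hpath⟩ ⟨_, hq v⟩)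
    simp only at heq
    rw [← heq]
    simp

/-- The graph of a single edge is acyclic. -/
theorem SimpleGraph.isAcyclic_fromEdgeSet_singleton {V : Type*} (e : Sym2 V) :
    (fromEdgeSet {e}).IsAcyclic := by
  induction e with
  | _ u v =>
    by_cases huv : u = v
    · subst huv
      have : fromEdgeSet {s(u, u)} = (⊥ : SimpleGraph V) := by
        ext a b
        simp only [fromEdgeSet_adj, Set.mem_singleton_iff, Sym2.eq_iff, bot_adj, iff_false]
        grind
      rw [this]
      exact isAcyclic_bot
    · have h := isAcyclic_bot.sup_edge_of_not_reachable
        (show ¬ (⊥ : SimpleGraph V).Reachable u v by simpa using huv)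
      rwa [bot_sup_eq] at h

/-- The edges of a finite graph can be partitioned into `arboricity G` forests. -/
theorem arboricityLE_arboricity {V : Type*} [Finite V] (G : SimpleGraph V) :
    ArboricityLE G (arboricity G) := by
  refine Nat.sInf_mem (s := {a | ArboricityLE G a}) ⟨Nat.card G.edgeSet, ?_⟩
  have f := (Finite.equivFin G.edgeSet).symm
  have hmem : ∀ i, (f i : Sym2 V) ∈ G.edgeSet := fun i => (f i).2
  refine ⟨fun i => fromEdgeSet {(f i : Sym2 V)}, fun i => ?_,
    fun i => isAcyclic_fromEdgeSet_singleton _, fun e he => ⟨f.symm ⟨e, he⟩, ?_, ?_⟩⟩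
  · intro u v h
    rw [fromEdgeSet_adj, Set.mem_singleton_iff] at h
    rw [← mem_edgeSet, h.1]
    exact hmem i
  · beta_reduce
    rw [edgeSet_fromEdgeSet]
    exact ⟨(congrArg Subtype.val (f.apply_symm_apply ⟨e, he⟩)).symm,
      G.not_isDiag_of_mem_edgeSet he⟩
  · intro i hi
    simp only [edgeSet_fromEdgeSet, Set.mem_sdiff, Set.mem_singleton_iff] at hi
    rw [Equiv.eq_symm_apply]
    exact Subtype.ext hi.1.symm

/-- A graph of arboricity at most `a` has an orientation with out-degrees at most `a`:
`head e` is the head of the edge `e`, and the out-neighbours of `u` are among the `p i u`. -/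
theorem ArboricityLE.exists_orientation {V : Type*} {G : SimpleGraph V} {a : ℕ}
    (h : ArboricityLE G a) :
    ∃ (head : Sym2 V → V) (p : Fin a → V → V), ∀ u v, G.Adj u v →
      (head s(u, v) = v ∧ ∃ i, p i u = v) ∨ (head s(u, v) = u ∧ ∃ i, p i v = u) := by
  obtain ⟨F, -, hac, hpart⟩ := h
  choose p hp using fun i => (hac i).exists_parent
  have key : ∀ e : Sym2 V, ∃ w : V, e ∈ G.edgeSet → ∃ u, e = s(u, w) ∧ ∃ i, p i u = w := by
    intro e
    induction e with
    | _ u v =>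
      by_cases he : s(u, v) ∈ G.edgeSet
      · obtain ⟨i, hi, -⟩ := hpart _ he
        rcases hp i u v hi with h | h
        · exact ⟨v, fun _ => ⟨u, rfl, i, h⟩⟩
        · exact ⟨u, fun _ => ⟨v, Sym2.eq_swap, i, h⟩⟩
      · exact ⟨u, fun h => absurd h he⟩
  choose head hhead using key
  refine ⟨head, p, fun u v huv => ?_⟩
  obtain ⟨x, hx, hi⟩ := hhead s(u, v) huv
  rcases Sym2.eq_iff.1 hx with ⟨h₁, h₂⟩ | ⟨h₁, h₂⟩
  · exact Or.inl ⟨h₂.symm, by rwa [h₁, h₂]⟩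
  · exact Or.inr ⟨h₁.symm, by rwa [h₂, h₁]⟩

/-- If all edges of the triangles in `S` lie in `H`, then `S` has at most `#H * a` members,
where `a` bounds the arboricity. -/
theorem ArboricityLE.card_triangles_le {V : Type*} [DecidableEq V]
    {G : SimpleGraph V} {a : ℕ} (h : ArboricityLE G a) (S : Finset (Finset V))
    (H : Finset (Sym2 V)) (hS : ∀ t ∈ S, G.IsNClique 3 t)
    (hH : ∀ t ∈ S, ∀ u ∈ t, ∀ v ∈ t, u ≠ v → s(u, v) ∈ H) :
    S.card ≤ H.card * a := by
  obtain ⟨head, p, hor⟩ := h.exists_orientation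
  have hsub : S ⊆ (H ×ˢ (Finset.univ : Finset (Fin a))).image
      (fun x => insert (p x.2 (head x.1)) x.1.toFinset) := by
    intro t ht
    have path : ∀ u v w, (∀ x, x ∈ t ↔ x = u ∨ x = v ∨ x = w) → u ≠ v → head s(u, v) = v → (∃ i, p i v = w) →
        t ∈ (H ×ˢ (Finset.univ : Finset (Fin a))).image
          (fun x => insert (p x.2 (head x.1)) x.1.toFinset) := by
      rintro u v w htu huv hh ⟨i, hi⟩
      refine Finset.mem_image.2 ⟨(s(u, v), i), ?_, ?_⟩
      · simpa using hH t ht u (by simp [htu]) v (by simp [htu]) huv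
      · ext x
        simp only [hh, hi, htu, Finset.mem_insert, Sym2.mem_toFinset, Sym2.mem_iff]
        tauto
    obtain ⟨x, y, z, hxy, hxz, hyz, rfl⟩ := is3Clique_iff.1 (hS _ ht)
    rcases hor x y hxy with ⟨h₁, i₁⟩ | ⟨h₁, i₁⟩ <;>
    rcases hor y z hyz with ⟨h₂, i₂⟩ | ⟨h₂, i₂⟩
    · exact path x y z (fun a => by simp) hxy.ne h₁ i₂
    · rcases hor x z hxz with ⟨h₃, i₃⟩ | ⟨h₃, i₃⟩
      · exact path x z y (fun a => by simp; tauto) hxz.ne h₃ i₂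
      · exact path z x y (fun a => by simp; tauto) hxz.ne' (by rwa [Sym2.eq_swap]) i₁
    · rcases hor x z hxz with ⟨h₃, i₃⟩ | ⟨h₃, i₃⟩
      · exact path y x z (fun a => by simp; tauto) hxy.ne' (by rwa [Sym2.eq_swap]) i₃
      · exact path y z x (fun a => by simp; tauto) hyz.ne h₂ i₃
    · exact path z y x (fun a => by simp; tauto) hyz.ne' (by rwa [Sym2.eq_swap]) i₁
  calc S.card ≤ _ := Finset.card_le_card hsub
    _ ≤ _ := Finset.card_image_le
    _ = H.card * a := by simp

/-- Every triangle has three edges, so the edges lie in at most `3T` triangles in total. -/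
theorem sum_triCount_le {V : Type*} [Fintype V] [DecidableEq V]
    (G : SimpleGraph V) [DecidableRel G.Adj] :
    ∑ e ∈ G.edgeFinset, triCount G e ≤ 3 * (G.cliqueFinset 3).card := by
  calc ∑ e ∈ G.edgeFinset, triCount G e
      = ∑ t ∈ G.cliqueFinset 3, (G.edgeFinset.filter (fun e => ∀ v ∈ e, v ∈ t)).card :=
        Finset.sum_card_bipartiteAbove_eq_sum_card_bipartiteBelow
          (fun (e : Sym2 V) (t : Finset V) => ∀ v ∈ e, v ∈ t)
    _ ≤ ∑ t ∈ G.cliqueFinset 3, 3 := by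
        refine Finset.sum_le_sum fun t ht => ?_
        obtain ⟨x, y, z, -, -, -, rfl⟩ := is3Clique_iff.1 (mem_cliqueFinset_iff.1 ht)
        refine (Finset.card_le_card (t := {s(x, y), s(x, z), s(y, z)}) ?_).trans
          Finset.card_le_three
        intro e he
        induction e with
        | _ u v =>
          simp only [Finset.mem_filter, mem_edgeFinset, mem_edgeSet, Sym2.mem_iff,
            forall_eq_or_imp, forall_eq, Finset.mem_insert, Finset.mem_singleton] at he
          have hne := he.1.ne
          simp only [Finset.mem_insert, Finset.mem_singleton, Sym2.eq_iff]
          grind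
    _ = 3 * (G.cliqueFinset 3).card := by simp [mul_comm]

/-- There are at most `3T/τ` τ-heavy edges. -/
theorem mul_card_heavy_edges_le {V : Type*} [Fintype V] [DecidableEq V]
    (G : SimpleGraph V) [DecidableRel G.Adj] (τ : ℝ) :
    τ * ((G.edgeFinset.filter (fun e => τ < (triCount G e : ℝ))).card : ℝ) ≤
      3 * ((G.cliqueFinset 3).card : ℝ) := by
  calc τ * ((G.edgeFinset.filter (fun e => τ < (triCount G e : ℝ))).card : ℝ)
      = ∑ e ∈ G.edgeFinset.filter (fun e => τ < (triCount G e : ℝ)), τ := by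
        simp [mul_comm]
    _ ≤ ∑ e ∈ G.edgeFinset.filter (fun e => τ < (triCount G e : ℝ)), (triCount G e : ℝ) :=
        Finset.sum_le_sum fun e he => (Finset.mem_filter.1 he).2.le
    _ ≤ ∑ e ∈ G.edgeFinset, (triCount G e : ℝ) :=
        Finset.sum_le_sum_of_subset_of_nonneg (Finset.filter_subset _ _)
          fun _ _ _ => Nat.cast_nonneg _
    _ ≤ 3 * ((G.cliqueFinset 3).card : ℝ) := by exact_mod_cast sum_triCount_le G

/-- In a finite simple graph with `T` triangles and arboricity at most `α`,
for any `τ > 0`, the number of τ-heavy triangles is at most `3Tα/τ`. -/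
theorem heavy_triangles_card_le {V : Type*} [Fintype V] [DecidableEq V]
    (G : SimpleGraph V) [DecidableRel G.Adj] (α : ℕ) (hα : arboricity G ≤ α)
    (τ : ℝ) (hτ : 0 < τ) :
    (((G.cliqueFinset 3).filter (fun t => IsHeavyTriangle G τ t)).card : ℝ) ≤
      3 * ((G.cliqueFinset 3).card : ℝ) * (α : ℝ) / τ := by
  set H := G.edgeFinset.filter (fun e => τ < (triCount G e : ℝ))
  have hcard : ((G.cliqueFinset 3).filter (fun t => IsHeavyTriangle G τ t)).card ≤
      H.card * arboricity G := by
    refine (arboricityLE_arboricity G).card_triangles_le _ H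
      (fun t ht => mem_cliqueFinset_iff.1 (Finset.mem_filter.1 ht).1) ?_
    intro t ht u hu v hv huv
    obtain ⟨htri, hheavy⟩ := Finset.mem_filter.1 ht
    refine Finset.mem_filter.2 ⟨?_, hheavy u hu v hv huv⟩
    rw [mem_edgeFinset, mem_edgeSet]
    exact (mem_cliqueFinset_iff.1 htri).isClique hu hv huv
  have hle : (((G.cliqueFinset 3).filter (fun t => IsHeavyTriangle G τ t)).card : ℝ) ≤
      H.card * α := by
    exact_mod_cast hcard.trans (Nat.mul_le_mul_left _ hα)
  rw [le_div_iff₀ hτ]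
  calc _ ≤ (H.card : ℝ) * α * τ := by gcongr
    _ = τ * H.card * α := by ring
    _ ≤ _ := mul_le_mul_of_nonneg_right (mul_card_heavy_edges_le G τ) (Nat.cast_nonneg α)
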